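/- Fix H > 0, 0 < B < 1, and a, b > 0 with a² ≤ b². Let x(s) = (1/H)·√(1 + B² + 2B·sin(Hs + 3π/2)), z(s) = ∫_{3π/(2H)}^{s + 3π/(2H)} (1 + B·sin(Ht))/√(1 + B² + 2B·sin(Ht)) dt, s₀ = (1/H)·arcsin(−B) + π/(2H), and ρ(s) = x(s) − (x'(s)/z'(s))·z(s)·(b²/a²) on [−s₀, s₀]. Then ρ'(0) = 0 and ρ'(s₀) = ((a² − b²)/a²)·B ≤ 0. -/

import Mathlib

open Real

/-- Kenmotsu's profile function `x(s) = (1/H)√(1 + B² + 2B sin(Hs + 3π/2))`. -/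
noncomputable def kenX (H B : ℝ) (s : ℝ) : ℝ :=
  (1 / H) * Real.sqrt (1 + B ^ 2 + 2 * B * Real.sin (H * s + 3 * Real.pi / 2))

/-- Kenmotsu's height function
`z(s) = ∫_{3π/(2H)}^{s + 3π/(2H)} (1 + B sin(Ht))/√(1 + B² + 2B sin(Ht)) dt`. -/
noncomputable def kenZ (H B : ℝ) (s : ℝ) : ℝ :=
  ∫ t in (3 * Real.pi / (2 * H))..(s + 3 * Real.pi / (2 * H)),
    (1 + B * Real.sin (H * t)) / Real.sqrt (1 + B ^ 2 + 2 * B * Real.sin (H * t))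

/-- The function `ρ` of the Kenmotsu unduloid. -/
noncomputable def kenRho (H B a b : ℝ) (s : ℝ) : ℝ :=
  kenX H B s - (deriv (kenX H B) s / deriv (kenZ H B) s) * kenZ H B s *
    (b ^ 2 / a ^ 2)

lemma one_add_sq_add_two_mul_mul_sin_pos {B : ℝ} (hB0 : 0 < B) (hB1 : B < 1) (θ : ℝ) :
    0 < 1 + B ^ 2 + 2 * B * sin θ := by
  nlinarith [neg_one_le_sin θ, sq_pos_of_pos (sub_pos.2 hB1)]

lemma one_sub_mul_cos_pos {B : ℝ} (hB0 : 0 < B) (hB1 : B < 1) (θ : ℝ) :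
    0 < 1 - B * cos θ := by
  nlinarith [cos_le_one θ]

lemma sin_add_three_pi_div_two (θ : ℝ) : sin (θ + 3 * π / 2) = -cos θ := by
  rw [show θ + 3 * π / 2 = θ - π / 2 + 2 * π by ring, sin_add_two_pi, sin_sub_pi_div_two]

lemma hasDerivAt_kenX {H B : ℝ} (hH : H ≠ 0) (hB0 : 0 < B) (hB1 : B < 1) (s : ℝ) :
    HasDerivAt (kenX H B) (B * sin (H * s) / √(1 + B ^ 2 - 2 * B * cos (H * s))) s := by
  have hpos : 0 < 1 + B ^ 2 - 2 * B * cos (H * s) := by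
    have := one_add_sq_add_two_mul_mul_sin_pos hB0 hB1 (H * s + 3 * π / 2)
    rw [sin_add_three_pi_div_two] at this
    linarith
  have hfun : kenX H B = fun s ↦ 1 / H * √(1 + B ^ 2 - 2 * B * cos (H * s)) := by
    funext s
    rw [kenX, sin_add_three_pi_div_two, mul_neg, ← sub_eq_add_neg]
  rw [hfun]
  have hcos : HasDerivAt (fun s ↦ cos (H * s)) (-sin (H * s) * H) s := by
    simpa using ((hasDerivAt_id s).const_mul H).cos
  refine ((((hcos.const_mul (2 * B)).const_sub (1 + B ^ 2)).sqrt hpos.ne').const_mul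
    (1 / H)).congr_deriv ?_
  have := (sqrt_pos.2 hpos).ne'
  field_simp

lemma hasDerivAt_kenZ {H B : ℝ} (hH : H ≠ 0) (hB0 : 0 < B) (hB1 : B < 1) (s : ℝ) :
    HasDerivAt (kenZ H B)
      ((1 - B * cos (H * s)) / √(1 + B ^ 2 - 2 * B * cos (H * s))) s := by
  have hcont : Continuous fun t ↦
      (1 + B * sin (H * t)) / √(1 + B ^ 2 + 2 * B * sin (H * t)) := by
    refine Continuous.div (by fun_prop) (by fun_prop) fun t ↦ ?_
    exact (sqrt_pos.2 (one_add_sq_add_two_mul_mul_sin_pos hB0 hB1 _)).ne'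
  have h := (hcont.integral_hasStrictDerivAt (3 * π / (2 * H))
    (s + 3 * π / (2 * H))).hasDerivAt.comp_add_const s (3 * π / (2 * H))
  have harg : H * (s + 3 * π / (2 * H)) = H * s + 3 * π / 2 := by field_simp
  rw [harg, sin_add_three_pi_div_two, mul_neg, mul_neg, ← sub_eq_add_neg, ← sub_eq_add_neg] at h
  exact h

lemma kenZ_zero (H B : ℝ) : kenZ H B 0 = 0 := by
  simp [kenZ]

lemma deriv_kenX_div_deriv_kenZ {H B : ℝ} (hH : H ≠ 0) (hB0 : 0 < B) (hB1 : B < 1) (s : ℝ) :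
    deriv (kenX H B) s / deriv (kenZ H B) s =
      B * sin (H * s) / (1 - B * cos (H * s)) := by
  rw [(hasDerivAt_kenX hH hB0 hB1 s).deriv, (hasDerivAt_kenZ hH hB0 hB1 s).deriv]
  refine div_div_div_cancel_right₀ (sqrt_pos.2 ?_).ne' _ _
  have := one_add_sq_add_two_mul_mul_sin_pos hB0 hB1 (H * s + 3 * π / 2)
  rw [sin_add_three_pi_div_two] at this
  linarith

lemma hasDerivAt_mul_sin_div_one_sub_mul_cos {H B : ℝ} (hB0 : 0 < B) (hB1 : B < 1) (s : ℝ) :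
    HasDerivAt (fun s ↦ B * sin (H * s) / (1 - B * cos (H * s)))
      (H * B * (cos (H * s) - B) / (1 - B * cos (H * s)) ^ 2) s := by
  have hlin : HasDerivAt (fun s ↦ H * s) H s := by
    simpa using (hasDerivAt_id s).const_mul H
  refine ((hlin.sin.const_mul B).div ((hlin.cos.const_mul B).const_sub 1)
    (one_sub_mul_cos_pos hB0 hB1 (H * s)).ne').congr_deriv ?_
  congr 1
  linear_combination (-(H * B ^ 2)) * sin_sq_add_cos_sq (H * s)

lemma hasDerivAt_kenRho {H B : ℝ} (a b : ℝ) (hH : H ≠ 0) (hB0 : 0 < B) (hB1 : B < 1) (s : ℝ) :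
    HasDerivAt (kenRho H B a b)
      (B * sin (H * s) / √(1 + B ^ 2 - 2 * B * cos (H * s)) * (1 - b ^ 2 / a ^ 2) -
        H * B * (cos (H * s) - B) / (1 - B * cos (H * s)) ^ 2 * kenZ H B s *
          (b ^ 2 / a ^ 2)) s := by
  have hfun : kenRho H B a b = fun s ↦ kenX H B s -
      B * sin (H * s) / (1 - B * cos (H * s)) * kenZ H B s * (b ^ 2 / a ^ 2) := by
    funext s
    rw [kenRho, deriv_kenX_div_deriv_kenZ hH hB0 hB1]
  rw [hfun]
  refine ((hasDerivAt_kenX hH hB0 hB1 s).sub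
    (((hasDerivAt_mul_sin_div_one_sub_mul_cos hB0 hB1 s).mul
      (hasDerivAt_kenZ hH hB0 hB1 s)).mul_const (b ^ 2 / a ^ 2))).congr_deriv ?_
  rw [add_mul, div_mul_div_cancel₀ (one_sub_mul_cos_pos hB0 hB1 (H * s)).ne']
  ring

/-- For the unduloid (`0 < B < 1`) with `a² ≤ b²`:
`ρ'(0) = 0` and `ρ'(s₀) = ((a² - b²)/a²) B ≤ 0`, where
`s₀ = (1/H) arcsin(-B) + π/(2H)`. -/
theorem unduloid_rho_deriv_endpoints (H B a b : ℝ) (hH : 0 < H) (hB0 : 0 < B)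
    (hB1 : B < 1) (ha : 0 < a) (hb : 0 < b) (hab : a ^ 2 ≤ b ^ 2) :
    deriv (kenRho H B a b) 0 = 0 ∧
    deriv (kenRho H B a b) ((1 / H) * Real.arcsin (-B) + Real.pi / (2 * H)) =
      ((a ^ 2 - b ^ 2) / a ^ 2) * B ∧
    ((a ^ 2 - b ^ 2) / a ^ 2) * B ≤ 0 := by
  refine ⟨?_, ?_, ?_⟩
  · rw [(hasDerivAt_kenRho a b hH.ne' hB0 hB1 0).deriv]
    simp [kenZ_zero]
  · have harg : H * ((1 / H) * arcsin (-B) + π / (2 * H)) = π / 2 - arcsin B := by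
      rw [arcsin_neg]
      field_simp
      ring
    have hsqrt : √(1 - B ^ 2) ≠ 0 := (sqrt_pos.2 (by nlinarith)).ne'
    rw [(hasDerivAt_kenRho a b hH.ne' hB0 hB1 _).deriv, harg, sin_pi_div_two_sub,
      cos_pi_div_two_sub, cos_arcsin, sin_arcsin (by linarith) hB1.le,
      show 1 + B ^ 2 - 2 * B * B = 1 - B ^ 2 by ring, mul_div_cancel_right₀ _ hsqrt]
    field_simp
    ring
  · exact mul_nonpos_of_nonpos_of_nonneg
      (div_nonpos_of_nonpos_of_nonneg (sub_nonpos.2 hab) (sq_nonneg a)) hB0.le
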